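/- Let p ≥ 1 and q ≥ 2 be integers with p+q odd. Then the non-alternating linear Euler T-sum T_{p,q}^{1,1} lies in the subalgebra of ℝ generated over ℚ by the set {π, ln 2} ∪ {ζ(2k+1) : k ≥ 1}. Moreover, for integers p ≥ 1 and q ≥ 1 with p+q odd, the alternating linear Euler T-sum T_{p,q}^{−1,−1} lies in the subalgebra of ℝ generated over ℚ by the set {π, ln 2, G} ∪ {ζ(2k+1) : k ≥ 1} ∪ {β(2k) : k ≥ 2}. -/

import Mathlib

open scoped BigOperators

/-- Alternating odd harmonic number `h_n^{(p)}(σ) = ∑_{k=1}^n σ^{k-1}/(k-1/2)^p`. -/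
noncomputable def oddH (n p : ℕ) (σ : ℝ) : ℝ :=
  ∑ k ∈ Finset.range n, σ ^ k / ((k : ℝ) + 1 / 2) ^ p

/-- Linear Euler T-sum `T_{p,q}^{σ1,σ2} = ∑_{n≥1} σ2^{n-1} h_{n-1}^{(p)}(σ1)/(n-1/2)^q`. -/
noncomputable def TSum (p q : ℕ) (σ1 σ2 : ℝ) : ℝ :=
  ∑' n : ℕ, σ2 ^ n * oddH n p σ1 / ((n : ℝ) + 1 / 2) ^ q

/-- The Riemann zeta value `ζ(s) = ∑_{n≥1} 1/n^s`. -/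
noncomputable def zetaVal (s : ℕ) : ℝ := ∑' n : ℕ, 1 / ((n : ℝ) + 1) ^ s

/-- The Dirichlet beta value `β(s) = ∑_{n≥1} (-1)^{n-1}/(2n-1)^s`. -/
noncomputable def betaVal (s : ℕ) : ℝ := ∑' n : ℕ, (-1 : ℝ) ^ n / (2 * (n : ℝ) + 1) ^ s

open Filter Topology

lemma hs_congr {ι : Type*} {f g : ι → ℝ} {a : ℝ} (h : HasSum f a) (e : ∀ i, g i = f i) :
    HasSum g a := by
  have : g = f := funext e
  rwa [this]

lemma sm_congr {ι : Type*} {f g : ι → ℝ} (h : Summable f) (e : ∀ i, g i = f i) :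
    Summable g := by
  have : g = f := funext e
  rwa [this]

lemma rat_mem' (S : Subalgebra ℚ ℝ) (r : ℚ) : (r : ℝ) ∈ S := by
  simpa using S.algebraMap_mem r

lemma sum_nat_pow (m : ℕ) (hm : 2 ≤ m) : Summable (fun n : ℕ => 1 / ((n : ℝ) + 1) ^ m) := by
  have := (summable_nat_add_iff 1).2 (Real.summable_one_div_nat_pow.2 (show 1 < m by omega))
  simpa using this

lemma sum_half_int (m : ℕ) (hm : 2 ≤ m) : Summable (fun n : ℤ => 1 / |(n : ℝ) + 1 / 2| ^ m) := by
  have := (Real.summable_one_div_int_add_rpow (1 / 2) m).2 (by exact_mod_cast hm)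
  simpa using this

lemma sum_half_int' (m : ℕ) (hm : 2 ≤ m) : Summable (fun n : ℤ => 1 / ((n : ℝ) + 1 / 2) ^ m) := by
  refine Summable.of_norm ?_
  simpa [abs_inv, abs_pow] using sum_half_int m hm

lemma sum_half_nat (m : ℕ) (hm : 2 ≤ m) : Summable (fun n : ℕ => 1 / ((n : ℝ) + 1 / 2) ^ m) := by
  have := (sum_half_int' m hm).comp_injective Nat.cast_injective
  simpa [Function.comp_def] using this

noncomputable def tval (m : ℕ) : ℝ := ∑' n : ℕ, 1 / ((n : ℝ) + 1 / 2) ^ m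

noncomputable def tauv (m : ℕ) : ℝ := ∑' n : ℤ, 1 / ((n : ℝ) + 1 / 2) ^ m

lemma tauv_odd (m : ℕ) (hm : Odd m) : tauv m = 0 := by
  have h : tauv m = - tauv m := by
    unfold tauv
    rw [← tsum_neg]
    rw [← (Equiv.subLeft (-1 : ℤ)).tsum_eq]
    refine tsum_congr fun n => ?_
    have : (((Equiv.subLeft (-1 : ℤ)) n : ℤ) : ℝ) + 1 / 2 = - ((n : ℝ) + 1 / 2) := by
      simp; ring
    rw [this, hm.neg_pow, div_neg]
  linarith

lemma tauv_even (m : ℕ) (hm : Even m) (h2 : 2 ≤ m) : tauv m = 2 * tval m := by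
  unfold tauv tval
  have e : ∀ n : ℕ, 1 / (((-((n : ℤ) + 1) : ℤ) : ℝ) + 1 / 2) ^ m = 1 / ((n : ℝ) + 1 / 2) ^ m := by
    intro n
    have : (((-((n : ℤ) + 1) : ℤ) : ℝ) + 1 / 2) = - ((n : ℝ) + 1 / 2) := by push_cast; ring
    rw [this, hm.neg_pow]
  rw [tsum_of_nat_of_neg_add_one]
  · simp_rw [e]; simp only [Int.cast_natCast]; ring
  · simpa using sum_half_nat m h2
  · simp_rw [e]; exact sum_half_nat m h2

lemma odd_part (m : ℕ) (x : ℝ) : (1:ℝ) / (2 * x + 1) ^ m = (1 / 2 ^ m) * (1 / (x + 1 / 2) ^ m) := by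
  rw [show 2 * x + 1 = 2 * (x + 1 / 2) by ring, mul_pow]; field_simp

lemma even_part (m : ℕ) (x : ℝ) : (1:ℝ) / (2 * x + 1 + 1) ^ m = (1 / 2 ^ m) * (1 / (x + 1) ^ m) := by
  rw [show 2 * x + 1 + 1 = 2 * (x + 1) by ring, mul_pow]; field_simp

lemma tval_eq (m : ℕ) (hm : 2 ≤ m) : tval m = (2 ^ m - 1) * zetaVal m := by
  have h1 := ((sum_half_nat m hm).hasSum.mul_left (1 / 2 ^ m : ℝ))
  have h2 := ((sum_nat_pow m hm).hasSum.mul_left (1 / 2 ^ m : ℝ))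
  have h3 : HasSum (fun n : ℕ => 1 / ((n : ℝ) + 1) ^ m) _ :=
    HasSum.even_add_odd (hs_congr h1 fun k => by push_cast; rw [odd_part])
      (hs_congr h2 fun k => by push_cast; rw [even_part])
  have h4 := h3.tsum_eq
  change zetaVal m = 1 / 2 ^ m * tval m + 1 / 2 ^ m * zetaVal m at h4
  field_simp at h4
  linarith

noncomputable def etav (m : ℕ) : ℝ := ∑' n : ℕ, (-1) ^ n / ((n : ℝ) + 1) ^ m

lemma etav_eq (m : ℕ) (hm : 2 ≤ m) : etav m = (1 - 2 / 2 ^ m) * zetaVal m := by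
  have h1 := ((sum_half_nat m hm).hasSum.mul_left (1 / 2 ^ m : ℝ))
  have h2 := ((sum_nat_pow m hm).hasSum.mul_left (1 / 2 ^ m : ℝ)).neg
  have h3 : HasSum (fun n : ℕ => (-1) ^ n / ((n : ℝ) + 1) ^ m) _ :=
    HasSum.even_add_odd (hs_congr h1 fun k => by push_cast; rw [← odd_part]; simp)
      (hs_congr h2 fun k => by push_cast; rw [← even_part]; simp [pow_succ, neg_div])
  have h4 := h3.tsum_eq
  change etav m = 1 / 2 ^ m * tval m + - (1 / 2 ^ m * zetaVal m) at h4
  rw [h4, tval_eq m hm]; field_simp; ring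

lemma zeta_even_mem (S : Subalgebra ℚ ℝ) (hpi : Real.pi ∈ S) (m : ℕ) (hm : Even m) (h2 : 2 ≤ m) :
    zetaVal m ∈ S := by
  obtain ⟨k, hk⟩ := hm
  have hk' : m = 2 * k := by omega
  subst hk'
  have h := (hasSum_nat_add_iff' 1).2 (hasSum_zeta_nat (k := k) (by omega))
  have h1 := h.tsum_eq
  have h0 : ((0 : ℝ)) ^ (2 * k) = 0 := by rw [zero_pow (by omega)]
  simp only [Nat.cast_add, Nat.cast_one, Finset.sum_range_one, Nat.cast_zero, h0, div_zero, sub_zero] at h1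
  change zetaVal (2 * k) = _ at h1
  rw [h1]
  have : (-1 : ℝ) ^ (k + 1) * (2 : ℝ) ^ (2 * k - 1) * Real.pi ^ (2 * k) *
        bernoulli (2 * k) / (Nat.factorial (2 * k))
      = (((-1) ^ (k + 1) * 2 ^ (2 * k - 1) * bernoulli (2 * k) / (Nat.factorial (2 * k)) : ℚ) : ℝ)
        * Real.pi ^ (2 * k) := by
    push_cast; ring
  rw [this]
  exact S.mul_mem (rat_mem' S _) (S.pow_mem hpi _)

lemma tval_even_mem (S : Subalgebra ℚ ℝ) (hpi : Real.pi ∈ S) (m : ℕ) (hm : Even m) (h2 : 2 ≤ m) :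
    tval m ∈ S := by
  rw [tval_eq m h2]
  have := rat_mem' S (2 ^ m - 1)
  push_cast at this
  exact S.mul_mem this (zeta_even_mem S hpi m hm h2)

lemma tauv_mem (S : Subalgebra ℚ ℝ) (hpi : Real.pi ∈ S) (m : ℕ) (hm : Even m) (h2 : 2 ≤ m) :
    tauv m ∈ S := by
  rw [tauv_even m hm h2]
  have := rat_mem' S 2
  push_cast at this
  exact S.mul_mem this (tval_even_mem S hpi m hm h2)

lemma zeta_odd_mem (S : Subalgebra ℚ ℝ) (hz : ∀ k, 1 ≤ k → zetaVal (2 * k + 1) ∈ S)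
    (m : ℕ) (hm : Odd m) (h2 : 2 ≤ m) : zetaVal m ∈ S := by
  obtain ⟨k, rfl⟩ := hm
  exact hz k (by omega)

lemma tval_odd_mem (S : Subalgebra ℚ ℝ) (hz : ∀ k, 1 ≤ k → zetaVal (2 * k + 1) ∈ S)
    (m : ℕ) (hm : Odd m) (h2 : 2 ≤ m) : tval m ∈ S := by
  rw [tval_eq m h2]
  have := rat_mem' S (2 ^ m - 1)
  push_cast at this
  exact S.mul_mem this (zeta_odd_mem S hz m hm h2)

lemma etav_odd_mem (S : Subalgebra ℚ ℝ) (hz : ∀ k, 1 ≤ k → zetaVal (2 * k + 1) ∈ S)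
    (m : ℕ) (hm : Odd m) (h2 : 2 ≤ m) : etav m ∈ S := by
  rw [etav_eq m h2]
  have := rat_mem' S (1 - 2 / 2 ^ m)
  push_cast at this
  exact S.mul_mem this (zeta_odd_mem S hz m hm h2)

noncomputable def bval (m : ℕ) : ℝ := ∑' n : ℕ, (-1) ^ n / ((n : ℝ) + 1 / 2) ^ m

lemma sum_bval (m : ℕ) (hm : 2 ≤ m) : Summable (fun n : ℕ => (-1 : ℝ) ^ n / ((n : ℝ) + 1 / 2) ^ m) := by
  refine Summable.of_norm_bounded (sum_half_nat m hm) fun n => ?_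
  have : 0 < (n : ℝ) + 1 / 2 := by positivity
  simp [abs_of_pos (by simpa using this : (0:ℝ) < n + 2⁻¹)]

lemma bval_eq (m : ℕ) : bval m = 2 ^ m * betaVal m := by
  unfold bval betaVal
  rw [← tsum_mul_left]
  refine tsum_congr fun n => ?_
  rw [show 2 * (n : ℝ) + 1 = 2 * (n + 1 / 2) by ring, mul_pow]
  field_simp

lemma beta_odd_mem (S : Subalgebra ℚ ℝ) (hpi : Real.pi ∈ S) (m : ℕ) (hm : Odd m) (h2 : 2 ≤ m) :
    betaVal m ∈ S := by
  obtain ⟨k, rfl⟩ := hm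
  have h := hasSum_one_div_nat_pow_mul_sin (k := k) (by omega) (x := 1 / 4) (by constructor <;> norm_num)
  have hs : Summable (fun n : ℕ => (-1 : ℝ) ^ n / (2 * (n : ℝ) + 1) ^ (2 * k + 1)) := by
    refine sm_congr ((sum_bval (2 * k + 1) h2).mul_left (1 / 2 ^ (2 * k + 1))) fun n => ?_
    rw [show 2 * (n : ℝ) + 1 = 2 * (n + 1 / 2) by ring, mul_pow]
    field_simp
  have h3 : HasSum (fun n : ℕ => 1 / (n : ℝ) ^ (2 * k + 1) * Real.sin (2 * Real.pi * n * (1 / 4)))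
      (0 + betaVal (2 * k + 1)) := by
    refine HasSum.even_add_odd ?_ ?_
    · refine hs_congr hasSum_zero fun n => ?_
      rw [show 2 * Real.pi * ((2 * n : ℕ) : ℝ) * (1 / 4) = n * Real.pi by push_cast; ring,
        Real.sin_nat_mul_pi, mul_zero]
    · refine hs_congr hs.hasSum fun n => ?_
      rw [show 2 * Real.pi * ((2 * n + 1 : ℕ) : ℝ) * (1 / 4) = Real.pi / 2 + n * Real.pi by push_cast; ring,
        Real.sin_add_nat_mul_pi]
      simp; field_simp
  have h4 := h3.unique h
  rw [zero_add] at h4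
  rw [h4]
  have e : (Polynomial.map (algebraMap ℚ ℝ) (Polynomial.bernoulli (2 * k + 1))).eval (1 / 4)
      = (((Polynomial.bernoulli (2 * k + 1)).eval (1 / 4) : ℚ) : ℝ) := by
    have := Polynomial.eval_map_apply (f := algebraMap ℚ ℝ) (p := Polynomial.bernoulli (2 * k + 1)) (1 / 4 : ℚ)
    simpa using this
  rw [e]
  have : (-1 : ℝ) ^ (k + 1) * (2 * Real.pi) ^ (2 * k + 1) / 2 / (Nat.factorial (2 * k + 1)) *
        (((Polynomial.bernoulli (2 * k + 1)).eval (1 / 4) : ℚ) : ℝ)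
      = (((-1) ^ (k + 1) * 2 ^ (2 * k + 1) / 2 / (Nat.factorial (2 * k + 1)) *
         (Polynomial.bernoulli (2 * k + 1)).eval (1 / 4) : ℚ) : ℝ)
        * Real.pi ^ (2 * k + 1) := by
    push_cast; ring
  rw [this]
  exact S.mul_mem (rat_mem' S _) (S.pow_mem hpi _)

/-- partial sums of the alternating harmonic series. -/
lemma alt_double (K : ℕ) : ∑ k ∈ Finset.range (2 * K), (-1 : ℝ) ^ k / ((k : ℝ) + 1)
    = (harmonic (2 * K) : ℝ) - harmonic K := by
  induction K with
  | zero => simp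
  | succ K ih =>
    rw [show 2 * (K + 1) = 2 * K + 1 + 1 by ring, Finset.sum_range_succ, Finset.sum_range_succ, ih,
      harmonic_succ, harmonic_succ, harmonic_succ]
    push_cast
    simp [pow_succ]
    field_simp
    ring

lemma harm_double : Tendsto (fun K : ℕ => (harmonic (2 * K) : ℝ) - harmonic K) atTop (𝓝 (Real.log 2)) := by
  have h1 := Real.tendsto_harmonic_sub_log
  have h2 : Tendsto (fun K : ℕ => 2 * K) atTop atTop :=
    tendsto_id.const_mul_atTop' (by norm_num)
  have h3 := (h1.comp h2).sub h1
  have h4 := h3.add_const (Real.log 2)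
  rw [sub_self, zero_add] at h4
  refine h4.congr' ?_
  filter_upwards [eventually_gt_atTop 0] with K hK
  have : (0 : ℝ) < K := by exact_mod_cast hK
  simp only [Function.comp]
  push_cast
  rw [Real.log_mul (by norm_num) this.ne']
  ring

lemma alt_log : Tendsto (fun K : ℕ => ∑ k ∈ Finset.range K, (-1 : ℝ) ^ k / ((k : ℝ) + 1) ^ 1) atTop
    (𝓝 (Real.log 2)) := by
  simp only [pow_one]
  have h : Tendsto (fun K : ℕ => ∑ k ∈ Finset.range (2 * K), (-1 : ℝ) ^ k / ((k : ℝ) + 1)) atTop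
    (𝓝 (Real.log 2)) := by
    simp_rw [alt_double]; exact harm_double
  have h' : Tendsto (fun K : ℕ => ∑ k ∈ Finset.range (2 * K + 1), (-1 : ℝ) ^ k / ((k : ℝ) + 1)) atTop
    (𝓝 (Real.log 2)) := by
    simp_rw [Finset.sum_range_succ]
    rw [← add_zero (Real.log 2)]
    refine h.add ?_
    simp
    have := (tendsto_one_div_add_atTop_nhds_zero_nat (𝕜 := ℝ)).comp
      ((tendsto_id (α := ℕ) (x := atTop)).const_mul_atTop' (r := 2) (by norm_num))
    simpa [Function.comp_def] using this
  rw [Metric.tendsto_atTop] at *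
  intro ε hε
  obtain ⟨N, hN⟩ := h ε hε
  obtain ⟨N', hN'⟩ := h' ε hε
  refine ⟨2 * (N + N') + 2, fun n hn => ?_⟩
  rcases Nat.even_or_odd' n with ⟨c, rfl | rfl⟩
  · exact hN c (by omega)
  · exact hN' c (by omega)
lemma half_abs (n : ℤ) : 1 / 2 ≤ |(n : ℝ) + 1 / 2| := by
  rcases le_or_gt 0 n with h | h
  · have : (0 : ℝ) ≤ n := by exact_mod_cast h
    rw [abs_of_nonneg (by linarith)]; linarith
  · have : (n : ℝ) ≤ -1 := by exact_mod_cast (by omega : n ≤ -1)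
    rw [abs_of_nonpos (by linarith)]; linarith

lemma half_ne (n : ℤ) : (n : ℝ) + 1 / 2 ≠ 0 := by
  intro h
  have := half_abs n
  rw [h] at this; norm_num at this

lemma kx (k : ℕ) (n : ℤ) : (k : ℝ) + 1 - ((n : ℝ) + 1 / 2) = (((k : ℤ) - n : ℤ) : ℝ) + 1 / 2 := by
  push_cast; ring

lemma inv_pow_le' {u : ℝ} (hu : 1 / 2 ≤ u) {j p : ℕ} (h : j ≤ p) :
    1 / u ^ p ≤ 2 ^ (p - j) * (1 / u ^ j) := by
  have hu0 : 0 < u := by linarith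
  obtain ⟨d, rfl⟩ := Nat.exists_eq_add_of_le h
  rw [Nat.add_sub_cancel_left, pow_add]
  have h1 : 1 ≤ 2 ^ d * u ^ d := by
    rw [← mul_pow]; exact one_le_pow₀ (by linarith)
  have hj : 0 < u ^ j := by positivity
  have hd : 0 < u ^ d := by positivity
  rw [mul_one_div, div_le_div_iff₀ (by positivity) hj]
  nlinarith

noncomputable def RR (p q k : ℕ) : ℝ :=
  ∑' n : ℤ, 1 / (((k : ℝ) + 1 - ((n : ℝ) + 1 / 2)) ^ p * ((n : ℝ) + 1 / 2) ^ q)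

lemma sum_shift (k : ℕ) (m : ℕ) :
    (Summable (fun n : ℤ => 1 / |(n : ℝ) + 1 / 2| ^ m)) →
    Summable (fun n : ℤ => 1 / |(k : ℝ) + 1 - ((n : ℝ) + 1 / 2)| ^ m) := by
  intro h
  have := h.comp_injective (Equiv.subLeft (k : ℤ)).injective
  refine sm_congr this fun n => ?_
  rw [kx]; rfl

lemma RR_summable (p q k : ℕ) (hp : 1 ≤ p) (hq : 1 ≤ q) : Summable (fun n : ℤ =>
    1 / (((k : ℝ) + 1 - ((n : ℝ) + 1 / 2)) ^ p * ((n : ℝ) + 1 / 2) ^ q)) := by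
  have h1 := sum_half_int 2 le_rfl
  have h2 := sum_shift k 2 h1
  refine Summable.of_norm_bounded ((h1.add h2).mul_left (2 ^ (p - 1) * 2 ^ (q - 1))) fun n => ?_
  have hx := half_abs ((k : ℤ) - n)
  rw [← kx] at hx
  have hy := half_abs n
  rw [Real.norm_eq_abs, abs_div, abs_mul, abs_pow, abs_pow, abs_one]
  set x := |(k : ℝ) + 1 - ((n : ℝ) + 1 / 2)|
  set y := |(n : ℝ) + 1 / 2|
  have hx0 : 0 < x := by linarith
  have hy0 : 0 < y := by linarith
  have e1 := inv_pow_le' hx hp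
  have e2 := inv_pow_le' hy hq
  rw [pow_one] at e1 e2
  calc 1 / (x ^ p * y ^ q) = (1 / x ^ p) * (1 / y ^ q) := by field_simp
    _ ≤ (2 ^ (p - 1) * (1 / x)) * (2 ^ (q - 1) * (1 / y)) := by gcongr
    _ = (2 ^ (p - 1) * 2 ^ (q - 1)) * ((1 / x) * (1 / y)) := by ring
    _ ≤ _ := by
      gcongr
      rw [← one_div_pow, ← one_div_pow]
      nlinarith [sq_nonneg (1 / x - 1 / y), sq_nonneg (1 / x), sq_nonneg (1 / y)]

lemma RR_zero_left (q k : ℕ) : RR 0 q k = tauv q := by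
  unfold RR tauv; simp

lemma RR_zero_right (p k : ℕ) : RR p 0 k = tauv p := by
  unfold RR tauv
  rw [← (Equiv.subLeft (k : ℤ)).tsum_eq]
  refine tsum_congr fun n => ?_
  rw [kx]; simp

lemma pf_term (k : ℕ) (n : ℤ) (p q : ℕ) :
    1 / (((k : ℝ) + 1 - ((n : ℝ) + 1 / 2)) ^ (p + 1) * ((n : ℝ) + 1 / 2) ^ (q + 1))
    = (1 / ((k : ℝ) + 1)) * (1 / (((k : ℝ) + 1 - ((n : ℝ) + 1 / 2)) ^ (p + 1) * ((n : ℝ) + 1 / 2) ^ q)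
      + 1 / (((k : ℝ) + 1 - ((n : ℝ) + 1 / 2)) ^ p * ((n : ℝ) + 1 / 2) ^ (q + 1))) := by
  have hx := half_ne ((k : ℤ) - n)
  rw [← kx] at hx
  have hy := half_ne n
  have hk : (k : ℝ) + 1 ≠ 0 := by positivity
  have e : (k : ℝ) + 1 = ((k : ℝ) + 1 - ((n : ℝ) + 1 / 2)) + ((n : ℝ) + 1 / 2) := by ring
  generalize (k : ℝ) + 1 - ((n : ℝ) + 1 / 2) = x at *
  generalize (n : ℝ) + 1 / 2 = y at *
  rw [e] at hk ⊢
  field_simp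
  ring

lemma sum_tau (q k : ℕ) (hq : 2 ≤ q) : Summable (fun n : ℤ =>
    1 / (((k : ℝ) + 1 - ((n : ℝ) + 1 / 2)) ^ 0 * ((n : ℝ) + 1 / 2) ^ q)) := by
  simpa using sum_half_int' q hq

lemma sum_tau' (p k : ℕ) (hq : 2 ≤ p) : Summable (fun n : ℤ =>
    1 / (((k : ℝ) + 1 - ((n : ℝ) + 1 / 2)) ^ p * ((n : ℝ) + 1 / 2) ^ 0)) := by
  have := (sum_half_int' p hq).comp_injective (Equiv.subLeft (k : ℤ)).injective
  refine sm_congr this fun n => ?_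
  rw [kx]; simp

lemma RR_gen_summable (p q k : ℕ) (h : 2 ≤ p + q) : Summable (fun n : ℤ =>
    1 / (((k : ℝ) + 1 - ((n : ℝ) + 1 / 2)) ^ p * ((n : ℝ) + 1 / 2) ^ q)) := by
  rcases Nat.eq_zero_or_pos p with rfl | hp
  · exact sum_tau q k (by omega)
  rcases Nat.eq_zero_or_pos q with rfl | hq
  · exact sum_tau' p k (by omega)
  exact RR_summable p q k hp hq

lemma RR_rec (p q k : ℕ) (h : 1 ≤ p + q) :
    RR (p + 1) (q + 1) k = (1 / ((k : ℝ) + 1)) * (RR (p + 1) q k + RR p (q + 1) k) := by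
  unfold RR
  rw [← Summable.tsum_add (RR_gen_summable _ _ _ (by omega)) (RR_gen_summable _ _ _ (by omega)),
    ← tsum_mul_left]
  exact tsum_congr fun n => pf_term k n p q

lemma tele_summable : Summable (fun n : ℤ => 1 / ((n : ℝ) + 1 / 2) - 1 / (((n + 1 : ℤ) : ℝ) + 1 / 2)) := by
  have h := ((RR_summable 1 1 0 le_rfl le_rfl).comp_injective (Equiv.addRight (1 : ℤ)).injective)
  refine sm_congr h.neg fun n => ?_
  have h1 := half_ne n
  have h2 := half_ne (n + 1)
  simp only [Function.comp, Equiv.coe_addRight, pow_one]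
  push_cast at *
  rw [show (0:ℝ) + 1 - ((n : ℝ) + 1 + 1 / 2) = -((n : ℝ) + 1 / 2) by ring, neg_mul, div_neg, neg_neg,
    div_sub_div _ _ h1 h2]
  congr 1
  ring

lemma tele_gen (g : ℤ → ℝ) (hs : Summable fun n : ℤ => g n - g (n + 1))
    (t1 : Tendsto (fun n : ℕ => g n) atTop (𝓝 0)) (t2 : Tendsto (fun n : ℕ => g (-(n : ℤ))) atTop (𝓝 0)) :
    HasSum (fun n : ℤ => g n - g (n + 1)) 0 := by
  have h1 : Summable (fun n : ℕ => g (n : ℤ) - g ((n : ℤ) + 1)) :=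
    hs.comp_injective (Nat.cast_injective (R := ℤ))
  have h2 : Summable (fun n : ℕ => g (-((n : ℤ) + 1)) - g (-((n : ℤ) + 1) + 1)) :=
    hs.comp_injective (i := fun n : ℕ => -((n : ℤ) + 1)) (fun a b h => by simpa using h)
  have a1 : HasSum (fun n : ℕ => g (n : ℤ) - g ((n : ℤ) + 1)) (g 0) := by
    rw [h1.hasSum_iff_tendsto_nat]
    have h := t1.const_sub (g 0)
    rw [sub_zero] at h
    refine h.congr fun n => ?_
    have := Finset.sum_range_sub' (fun n : ℕ => g (n : ℤ)) n
    push_cast at this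
    exact this.symm
  have a2 : HasSum (fun n : ℕ => g (-((n : ℤ) + 1)) - g (-((n : ℤ) + 1) + 1)) (- g 0) := by
    rw [h2.hasSum_iff_tendsto_nat]
    have h := t2.sub_const (g 0)
    rw [zero_sub] at h
    refine h.congr fun n => ?_
    have := Finset.sum_range_sub (fun n : ℕ => g (-(n : ℤ))) n
    push_cast at this
    rw [neg_zero] at this
    rw [← this]
    refine Finset.sum_congr rfl fun k _ => ?_
    rw [show -((k : ℤ) + 1) + 1 = -(k : ℤ) by ring]
  have := HasSum.of_nat_of_neg_add_one (f := fun n : ℤ => g n - g (n + 1)) a1 a2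
  rwa [add_neg_cancel] at this

lemma tele_zero : HasSum (fun n : ℤ => 1 / ((n : ℝ) + 1 / 2) - 1 / (((n + 1 : ℤ) : ℝ) + 1 / 2)) 0 := by
  refine tele_gen (fun n : ℤ => 1 / ((n : ℝ) + 1 / 2)) tele_summable ?_ ?_
  · simp only [Int.cast_natCast]
    exact tendsto_const_nhds.div_atTop (tendsto_atTop_add_const_right _ _ tendsto_natCast_atTop_atTop)
  · simp only [Int.cast_natCast, Int.cast_neg]
    refine tendsto_const_nhds.div_atBot ?_
    exact tendsto_atBot_add_const_right _ _ (tendsto_neg_atTop_atBot.comp tendsto_natCast_atTop_atTop)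

lemma tele_k (k : ℕ) : HasSum (fun n : ℤ => 1 / ((n : ℝ) + 1 / 2) - 1 / (((n + k : ℤ) : ℝ) + 1 / 2)) 0 := by
  induction k with
  | zero => simp
  | succ k ih =>
    have h := (Equiv.addRight (k : ℤ)).hasSum_iff.2 tele_zero
    have := ih.add h
    rw [add_zero] at this
    refine hs_congr this fun n => ?_
    simp only [Function.comp, Equiv.coe_addRight]
    push_cast
    ring

lemma RR_one_one (k : ℕ) : RR 1 1 k = 0 := by
  have h := (Equiv.subRight ((k + 1 : ℕ) : ℤ)).hasSum_iff.2 (tele_k (k + 1))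
  have h2 := h.neg.mul_left (1 / ((k : ℝ) + 1))
  rw [neg_zero, mul_zero] at h2
  refine HasSum.tsum_eq (hs_congr h2 fun n => ?_)
  rw [pf_term k n 0 0]
  have hx := half_ne ((k : ℤ) - n)
  rw [← kx] at hx
  simp only [Function.comp, Equiv.subRight_apply]
  push_cast
  rw [show (n : ℝ) - (k + 1) + 1 / 2 = - ((k : ℝ) + 1 - ((n : ℝ) + 1 / 2)) by ring,
    show (n : ℝ) - (k + 1) + (k + 1) + 1 / 2 = n + 1 / 2 by ring, div_neg]
  simp only [pow_one, pow_zero, mul_one, one_mul]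
  ring

/-- span of functions `c / (k+1)^e` -/
noncomputable def WW (S : Subalgebra ℚ ℝ) (m : ℕ) : Submodule ℚ (ℕ → ℝ) :=
  Submodule.span ℚ {f | ∃ (e : ℕ) (c : ℝ), 2 ≤ e ∧ Even (m + e) ∧ c ∈ S ∧
    f = fun k : ℕ => c * (1 / ((k : ℝ) + 1) ^ e)}

lemma WW_mul (S : Subalgebra ℚ ℝ) (m : ℕ) (f : ℕ → ℝ) (hf : f ∈ WW S m) :
    (fun k : ℕ => (1 / ((k : ℝ) + 1)) * f k) ∈ WW S (m + 1) := by
  unfold WW at hf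
  induction hf using Submodule.span_induction with
  | mem f h =>
    obtain ⟨e, c, he, hp, hc, rfl⟩ := h
    refine Submodule.subset_span ⟨e + 1, c, by omega, ?_, hc, ?_⟩
    · rw [show m + 1 + (e + 1) = m + e + 2 by ring]; exact hp.add even_two
    · funext k; field_simp; ring
  | zero => simp only [Pi.zero_apply, mul_zero]; exact (WW S (m + 1)).zero_mem
  | add f g _ _ h1 h2 =>
    convert! (WW S (m + 1)).add_mem h1 h2 using 1
    funext k; simp [mul_add]
  | smul a f _ h =>
    convert! (WW S (m + 1)).smul_mem a h using 1
    funext k; simp [Rat.smul_def]; ring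

lemma WW_tau (S : Subalgebra ℚ ℝ) (hpi : Real.pi ∈ S) (m e j : ℕ) (he : 2 ≤ e) (hm : m = e + j)
    (hj : 1 ≤ j) :
    (fun k : ℕ => tauv j * (1 / ((k : ℝ) + 1) ^ e)) ∈ WW S m := by
  rcases Nat.even_or_odd j with h | h
  · refine Submodule.subset_span ⟨e, tauv j, he, ?_, ?_, rfl⟩
    · subst hm; rw [show e + j + e = 2 * e + j by ring]; exact (even_two_mul e).add h
    · refine tauv_mem S hpi j h ?_
      obtain ⟨r, rfl⟩ := h; omega
  · rw [tauv_odd j h]; simp only [zero_mul]; exact (WW S m).zero_mem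

lemma RR_mem (S : Subalgebra ℚ ℝ) (hpi : Real.pi ∈ S) (N : ℕ) : ∀ p q : ℕ, p + q = N →
    (fun k : ℕ => RR (p + 1) (q + 1) k - tauv (q + 1) * (1 / ((k : ℝ) + 1) ^ (p + 1))
      - tauv (p + 1) * (1 / ((k : ℝ) + 1) ^ (q + 1))) ∈ WW S (p + q + 2) := by
  induction N with
  | zero =>
    intro p q h
    obtain ⟨rfl, rfl⟩ : p = 0 ∧ q = 0 := by omega
    have := tauv_odd 1 odd_one
    simp only [zero_add, RR_one_one, this]
    simp only [zero_mul, sub_zero]; exact (WW S 2).zero_mem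
  | succ N ih =>
    intro p q h
    -- general
    have key : ∀ k, RR (p + 1) (q + 1) k = (1 / ((k : ℝ) + 1)) * (RR (p + 1) q k + RR p (q + 1) k) :=
      fun k => RR_rec p q k (by omega)
    have A : (fun k : ℕ => (1 / ((k : ℝ) + 1)) * RR (p + 1) q k
        - tauv (p + 1) * (1 / ((k : ℝ) + 1) ^ (q + 1))) ∈ WW S (p + q + 2) := by
      rcases q with _ | q
      · convert! (WW S (p + 0 + 2)).zero_mem using 1
        funext k; rw [RR_zero_right]; simp; ring
      · have h1 := WW_mul S _ _ (ih p q (by omega))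
        have h2 := WW_tau S hpi (p + (q + 1) + 2) (p + 2) (q + 1) (by omega) (by omega) (by omega)
        rw [show p + q + 2 + 1 = p + (q + 1) + 2 by ring] at h1
        convert! Submodule.add_mem _ h1 h2 using 1
        funext k
        have hk : (k : ℝ) + 1 ≠ 0 := by positivity
        simp only [Pi.add_apply]
        field_simp
        ring
    have B : (fun k : ℕ => (1 / ((k : ℝ) + 1)) * RR p (q + 1) k
        - tauv (q + 1) * (1 / ((k : ℝ) + 1) ^ (p + 1))) ∈ WW S (p + q + 2) := by
      rcases p with _ | p
      · convert! (WW S (0 + q + 2)).zero_mem using 1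
        funext k; rw [RR_zero_left]; simp; ring
      · have h1 := WW_mul S _ _ (ih p q (by omega))
        have h2 := WW_tau S hpi (p + 1 + q + 2) (q + 2) (p + 1) (by omega) (by omega) (by omega)
        rw [show p + q + 2 + 1 = p + 1 + q + 2 by ring] at h1
        convert! Submodule.add_mem _ h1 h2 using 1
        funext k
        have hk : (k : ℝ) + 1 ≠ 0 := by positivity
        simp only [Pi.add_apply]
        field_simp
        ring
    convert! Submodule.add_mem _ A B using 1
    funext k
    rw [key]; simp only [Pi.add_apply]; ring

lemma WW_sum (S : Subalgebra ℚ ℝ) (hz : ∀ k, 1 ≤ k → zetaVal (2 * k + 1) ∈ S) (s : ℝ)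
    (hs : s = 1 ∨ s = -1) (m : ℕ) (hm : Odd m) (f : ℕ → ℝ) (hf : f ∈ WW S m) :
    Summable (fun k => s ^ k * f k) ∧ ∑' k, s ^ k * f k ∈ S := by
  unfold WW at hf
  induction hf using Submodule.span_induction with
  | mem f h =>
    obtain ⟨e, c, he, hp, hc, rfl⟩ := h
    have hodd : Odd e := by
      rcases Nat.even_or_odd e with h | h
      · exact absurd hp (Nat.not_even_iff_odd.2 (hm.add_even h))
      · exact h
    have e1 : ∀ k : ℕ, s ^ k * (c * (1 / ((k : ℝ) + 1) ^ e)) = c * (s ^ k / ((k : ℝ) + 1) ^ e) := by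
      intro k; ring
    simp_rw [e1]
    constructor
    · refine Summable.mul_left _ (Summable.of_norm_bounded (sum_nat_pow e he) fun k => ?_)
      rw [norm_div, norm_pow, norm_pow]
      have : ‖s‖ = 1 := by rcases hs with rfl | rfl <;> simp
      have h2 : ‖(k : ℝ) + 1‖ = k + 1 := by rw [Real.norm_eq_abs, abs_of_pos]; positivity
      rw [this, one_pow, h2]
    · rw [tsum_mul_left]
      refine S.mul_mem hc ?_
      rcases hs with rfl | rfl
      · simpa [zetaVal] using zeta_odd_mem S hz e hodd he
      · exact etav_odd_mem S hz e hodd he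
  | zero => simp
  | add f g _ _ h1 h2 =>
    simp only [Pi.add_apply, mul_add]
    refine ⟨h1.1.add h2.1, ?_⟩
    rw [h1.1.tsum_add h2.1]
    exact S.add_mem h1.2 h2.2
  | smul a f _ h =>
    have e1 : ∀ k : ℕ, s ^ k * (a • f) k = a * (s ^ k * f k) := by
      intro k; simp [Rat.smul_def]; ring
    simp_rw [e1]
    refine ⟨h.1.mul_left _, ?_⟩
    rw [tsum_mul_left]
    exact S.mul_mem (rat_mem' S a) h.2
lemma sqrt_cube (x : ℝ) (hx : 0 ≤ x) : x ^ (3 / 2 : ℝ) = (√x) ^ 3 := by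
  rw [Real.sqrt_eq_rpow, ← Real.rpow_natCast, ← Real.rpow_mul hx]; norm_num

lemma sum_phi : Summable (fun n : ℤ => 1 / (√|(n : ℝ) + 1 / 2|) ^ 3) := by
  have := (Real.summable_one_div_int_add_rpow (1 / 2) (3 / 2)).2 (by norm_num)
  refine sm_congr this fun n => ?_
  rw [sqrt_cube _ (abs_nonneg _)]

lemma sum_phi_nat : Summable (fun n : ℕ => 1 / (√((n : ℝ) + 1)) ^ 3) := by
  have := (Real.summable_one_div_nat_add_rpow 1 (3 / 2)).2 (by norm_num)
  refine sm_congr this fun n => ?_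
  rw [sqrt_cube _ (abs_nonneg _), abs_of_nonneg (by positivity)]

lemma sum_major : Summable (fun z : ℕ × ℤ => (1 / (√|(z.2 : ℝ) + 1 / 2|) ^ 3) *
    (1 / (√|(z.1 : ℝ) + 1 - ((z.2 : ℝ) + 1 / 2)|) ^ 3 + 1 / (√((z.1 : ℝ) + 1)) ^ 3)) := by
  have h1 := Summable.mul_of_nonneg sum_phi sum_phi (fun n => by positivity) (fun n => by positivity)
  have h2 := Summable.mul_of_nonneg sum_phi_nat sum_phi (fun n => by positivity) (fun n => by positivity)
  have hinj : Function.Injective (fun z : ℕ × ℤ => ((z.1 : ℤ) - z.2, z.2)) := by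
    rintro ⟨a, b⟩ ⟨c, d⟩ h
    simp only [Prod.mk.injEq] at h
    obtain ⟨h1, h2⟩ := h
    ext
    · simp; omega
    · exact h2
  have h3 := h1.comp_injective hinj
  refine sm_congr (h3.add h2) fun z => ?_
  simp only [Function.comp]
  rw [kx]
  ring

lemma key_bound (u v α : ℝ) (hu : 1 / 2 ≤ u) (hv : 1 ≤ v) (hα : 1 / 2 ≤ α) (h : α ≤ u + v) :
    α / (u * v) ≤ √α * (1 / √u ^ 3 + 1 / √v ^ 3) := by
  have hU : 0 < √u := Real.sqrt_pos.2 (by linarith)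
  have hV : 0 < √v := Real.sqrt_pos.2 (by linarith)
  have hA : 0 < √α := Real.sqrt_pos.2 (by linarith)
  have eu : u = √u ^ 2 := (Real.sq_sqrt (by linarith)).symm
  have ev : v = √v ^ 2 := (Real.sq_sqrt (by linarith)).symm
  have ea : α = √α ^ 2 := (Real.sq_sqrt (by linarith)).symm
  rw [eu, ev, ea] at h
  have lhs : α / (u * v) = √α ^ 2 / (√u ^ 2 * √v ^ 2) := by rw [← eu, ← ev, ← ea]
  rw [lhs]
  clear lhs eu ev ea
  generalize √u = U at *
  generalize √v = V at *
  generalize √α = A at *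
  have hle : A ≤ U + V := by nlinarith
  have e : A * (1 / U ^ 3 + 1 / V ^ 3) = A * (U ^ 3 + V ^ 3) / (U ^ 3 * V ^ 3) := by
    field_simp; ring
  rw [e, div_le_div_iff₀ (by positivity) (by positivity)]
  have h2 : A * (U * V) ≤ U ^ 3 + V ^ 3 := by
    have : (U + V) * (U * V) ≤ U ^ 3 + V ^ 3 := by
      nlinarith [mul_nonneg (add_pos hU hV).le (sq_nonneg (U - V))]
    nlinarith [mul_pos hU hV]
  have h3 : 0 ≤ A * (U ^ 2 * V ^ 2) := by positivity
  nlinarith [mul_le_mul_of_nonneg_left h2 h3]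

lemma sq_half {u : ℝ} (hu : 1 / 2 ≤ u) : 1 / 2 ≤ √u := by
  apply Real.le_sqrt_of_sq_le; norm_num; linarith

lemma pow_sq {u : ℝ} (hu : 1 / 2 ≤ u) (p : ℕ) : u ^ p = √u ^ (2 * p) := by
  rw [pow_mul, Real.sq_sqrt (by linarith)]

noncomputable def ff (p q : ℕ) (s : ℝ) (k : ℕ) (n : ℤ) : ℝ :=
  s ^ k * (1 / ((k : ℝ) + 1 - ((n : ℝ) + 1 / 2)) ^ p - 1 / ((k : ℝ) + 1) ^ p) *
    (1 / ((n : ℝ) + 1 / 2) ^ q)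

lemma ff_summable (p q : ℕ) (s : ℝ) (hs : s = 1 ∨ s = -1) (hp : 1 ≤ p) (hq : 2 ≤ q) :
    Summable (Function.uncurry (ff p q s)) := by
  refine Summable.of_norm_bounded (sum_major.mul_left (2 ^ (2 * p - 2) * 2 ^ (2 * q - 3))) ?_
  rintro ⟨k, n⟩
  have hs1 : |s| = 1 := by rcases hs with rfl | rfl <;> simp
  simp only [Function.uncurry, ff]
  rw [Real.norm_eq_abs, abs_mul, abs_mul, abs_pow, hs1, one_pow, one_mul, abs_div, abs_one, abs_pow]
  have hx := half_abs ((k : ℤ) - n)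
  have hx0 := half_ne ((k : ℤ) - n)
  rw [← kx] at hx hx0
  have hy := half_abs n
  have hv : (1 : ℝ) ≤ (k : ℝ) + 1 := by linarith [(Nat.cast_nonneg k : (0 : ℝ) ≤ k)]
  have hxy : (k : ℝ) + 1 = ((k : ℝ) + 1 - ((n : ℝ) + 1 / 2)) + ((n : ℝ) + 1 / 2) := by ring
  generalize (k : ℝ) + 1 - ((n : ℝ) + 1 / 2) = x at *
  generalize (n : ℝ) + 1 / 2 = y at *
  generalize (k : ℝ) + 1 = v at *
  have hA : 0 < √|y| := Real.sqrt_pos.2 (by linarith)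
  have hU : 0 < √|x| := Real.sqrt_pos.2 (by linarith)
  have hV : 0 < √v := Real.sqrt_pos.2 (by linarith)
  rcases Nat.lt_or_ge 1 p with hp1 | hp1
  · have b1 : |1 / x ^ p - 1 / v ^ p| ≤ 2 ^ (2 * p - 3) * (1 / √|x| ^ 3 + 1 / √v ^ 3) := by
      refine (abs_sub _ _).trans ?_
      rw [abs_div, abs_div, abs_pow, abs_pow, abs_one, abs_of_pos (by linarith : 0 < v), mul_add,
        pow_sq hx, pow_sq (by linarith : 1 / 2 ≤ v)]
      exact add_le_add (inv_pow_le' (sq_half hx) (by omega)) (inv_pow_le' (sq_half (by linarith)) (by omega))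
    have b2 : 1 / |y| ^ q ≤ 2 ^ (2 * q - 3) * (1 / √|y| ^ 3) := by
      rw [pow_sq hy]; exact inv_pow_le' (sq_half hy) (by omega)
    calc _ ≤ (2 ^ (2 * p - 3) * (1 / √|x| ^ 3 + 1 / √v ^ 3)) * (2 ^ (2 * q - 3) * (1 / √|y| ^ 3)) := by
          gcongr
      _ ≤ (2 ^ (2 * p - 2) * (1 / √|x| ^ 3 + 1 / √v ^ 3)) * (2 ^ (2 * q - 3) * (1 / √|y| ^ 3)) := by
          gcongr
          · norm_num
          · omega
      _ = _ := by ring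
  · obtain rfl : p = 1 := by omega
    have b1 : |1 / x ^ 1 - 1 / v ^ 1| ≤ √|y| * (1 / √|x| ^ 3 + 1 / √v ^ 3) := by
      have e : 1 / x ^ 1 - 1 / v ^ 1 = y / (x * v) := by
        rw [pow_one, pow_one, div_sub_div _ _ hx0 (by linarith)]
        congr 1; linarith
      rw [e, abs_div, abs_mul, abs_of_pos (by linarith : 0 < v)]
      refine key_bound _ _ _ hx hv hy ?_
      have : y = v - x := by linarith
      rw [this]
      refine (abs_sub _ _).trans ?_
      rw [abs_of_pos (by linarith : 0 < v)]; linarith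
    have b2 : 1 / |y| ^ q ≤ 2 ^ (2 * q - 4) * (1 / √|y| ^ 4) := by
      rw [pow_sq hy]; exact inv_pow_le' (sq_half hy) (by omega)
    calc _ ≤ (√|y| * (1 / √|x| ^ 3 + 1 / √v ^ 3)) * (2 ^ (2 * q - 4) * (1 / √|y| ^ 4)) := by
          gcongr
      _ = 2 ^ (2 * q - 4) * (1 / √|y| ^ 3 * (1 / √|x| ^ 3 + 1 / √v ^ 3)) := by
          field_simp
      _ ≤ 2 ^ (2 * q - 3) * (1 / √|y| ^ 3 * (1 / √|x| ^ 3 + 1 / √v ^ 3)) := by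
          gcongr
          · norm_num
          · omega
      _ = _ := by ring

noncomputable def EE (p : ℕ) (s : ℝ) (n : ℤ) : ℝ :=
  ∑' k : ℕ, s ^ k * (1 / ((k : ℝ) + 1 - ((n : ℝ) + 1 / 2)) ^ p - 1 / ((k : ℝ) + 1) ^ p)

lemma EE_summable (p : ℕ) (s : ℝ) (hs : s = 1 ∨ s = -1) (hp : 1 ≤ p) (n : ℤ) :
    Summable (fun k : ℕ => s ^ k * (1 / ((k : ℝ) + 1 - ((n : ℝ) + 1 / 2)) ^ p - 1 / ((k : ℝ) + 1) ^ p)) := by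
  have h := ((ff_summable p 2 s hs hp le_rfl).prod_symm.prod_factor n).mul_right (((n : ℝ) + 1 / 2) ^ 2)
  have hn := half_ne n
  refine sm_congr h fun k => ?_
  simp only [Prod.swap, Function.uncurry, ff]
  rw [mul_assoc _ (1 / ((n : ℝ) + 1 / 2) ^ 2), one_div_mul_cancel (pow_ne_zero 2 hn), mul_one]

lemma EE_rec (p : ℕ) (s : ℝ) (hs : s = 1 ∨ s = -1) (hp : 1 ≤ p) (M : ℝ)
    (hM : Tendsto (fun K : ℕ => (s - 1) * ∑ k ∈ Finset.range K, s ^ k / ((k : ℝ) + 1) ^ p) atTop (𝓝 M))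
    (n : ℤ) : EE p s (n + 1) = s * EE p s n + 1 / (-((n : ℝ) + 1 / 2)) ^ p + M := by
  have h1 := (EE_summable p s hs hp (n + 1)).hasSum.tendsto_sum_nat
  have h2 := (EE_summable p s hs hp n).hasSum.tendsto_sum_nat
  have t0 : Tendsto (fun K : ℕ => s ^ K / ((K : ℝ) - ((n : ℝ) + 1 / 2)) ^ p) atTop (𝓝 0) := by
    have hs1 : |s| = 1 := by rcases hs with rfl | rfl <;> simp
    rw [tendsto_zero_iff_abs_tendsto_zero]
    have : Tendsto (fun K : ℕ => 1 / |((K : ℝ) - ((n : ℝ) + 1 / 2)) ^ p|) atTop (𝓝 0) := by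
      refine tendsto_const_nhds.div_atTop (tendsto_abs_atTop_atTop.comp ?_)
      refine (tendsto_pow_atTop (by omega)).comp ?_
      exact tendsto_atTop_add_const_right _ _ tendsto_natCast_atTop_atTop
    refine this.congr fun K => ?_
    simp only [Function.comp, abs_div, abs_pow, hs1, one_pow]
  have h3 := ((h2.const_mul s).add (t0.const_sub (1 / (-((n : ℝ) + 1 / 2)) ^ p))).add hM
  rw [sub_zero] at h3
  refine tendsto_nhds_unique h1 (h3.congr fun K => ?_)
  have tl := Finset.sum_range_sub' (fun k : ℕ => s ^ k / ((k : ℝ) - ((n : ℝ) + 1 / 2)) ^ p) K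
  simp only [pow_zero, Nat.cast_zero, zero_sub] at tl
  rw [← tl, Finset.mul_sum, Finset.mul_sum, ← Finset.sum_add_distrib, ← Finset.sum_add_distrib]
  refine Finset.sum_congr rfl fun k _ => ?_
  push_cast
  rw [show (k : ℝ) + 1 - ((n : ℝ) + 1 + 1 / 2) = k - (n + 1 / 2) by ring]
  ring

lemma EE_nat (p : ℕ) (s : ℝ) (hs : s = 1 ∨ s = -1) (M L : ℝ) (hML : M = (s - 1) * L)
    (h : ∀ n : ℤ, EE p s (n + 1) = s * EE p s n + 1 / (-((n : ℝ) + 1 / 2)) ^ p + M) (n : ℕ) :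
    EE p s n = s ^ n * (EE p s 0 + L) + (-1) ^ p * s ^ (n + 1) * oddH n p s - L := by
  have hss : s * s = 1 := by rcases hs with rfl | rfl <;> simp
  induction n with
  | zero => simp [oddH]
  | succ n ih =>
    have hsn : s ^ n * s ^ n = 1 := by rw [← mul_pow, hss, one_pow]
    have e : (1 : ℝ) / (-((n : ℝ) + 1 / 2)) ^ p = (-1) ^ p * (1 / ((n : ℝ) + 1 / 2) ^ p) := by
      rw [neg_pow]
      rcases neg_one_pow_eq_or ℝ p with h | h <;> rw [h] <;> simp
    have := h n
    push_cast at this ⊢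
    rw [this, ih, e, hML]
    unfold oddH
    rw [Finset.sum_range_succ]
    have : (-1 : ℝ) ^ p * s ^ (n + 1 + 1) * (s ^ n / ((n : ℝ) + 1 / 2) ^ p)
      = (-1) ^ p * (1 / ((n : ℝ) + 1 / 2) ^ p) := by
      rw [show (-1 : ℝ) ^ p * s ^ (n + 1 + 1) * (s ^ n / ((n : ℝ) + 1 / 2) ^ p)
        = (s ^ n * s ^ n) * (s * s) * ((-1) ^ p * (1 / ((n : ℝ) + 1 / 2) ^ p)) by ring, hsn, hss]
      ring
    linear_combination -this

lemma EE_neg (p : ℕ) (s : ℝ) (hs : s = 1 ∨ s = -1) (M L : ℝ) (hML : M = (s - 1) * L)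
    (h : ∀ n : ℤ, EE p s (n + 1) = s * EE p s n + 1 / (-((n : ℝ) + 1 / 2)) ^ p + M) (n : ℕ) :
    EE p s (-((n : ℤ) + 1)) = s ^ (n + 1) * (EE p s 0 + L - oddH (n + 1) p s) - L := by
  have hss : s * s = 1 := by rcases hs with rfl | rfl <;> simp
  have e : ∀ m : ℕ, EE p s (-((m : ℤ) + 1)) = s * EE p s (-(m : ℤ)) - s * (1 / ((m : ℝ) + 1 / 2) ^ p) - s * M := by
    intro m
    have := h (-((m : ℤ) + 1))
    push_cast at this
    rw [show -((m : ℤ) + 1) + 1 = -(m : ℤ) by ring,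
      show -(-((m : ℝ) + 1) + 1 / 2) = m + 1 / 2 by ring] at this
    rw [this]
    linear_combination (-EE p s (-((m : ℤ) + 1))) * hss
  have f : ∀ m : ℕ, s ^ (m + 1) * (s ^ m / ((m : ℝ) + 1 / 2) ^ p) = s * (1 / ((m : ℝ) + 1 / 2) ^ p) := by
    intro m
    have hsn : s ^ m * s ^ m = 1 := by rw [← mul_pow, hss, one_pow]
    linear_combination (s * (1 / ((m : ℝ) + 1 / 2) ^ p)) * hsn
  induction n with
  | zero =>
    have := e 0
    have f0 := f 0
    simp only [Nat.cast_zero, zero_add, neg_zero] at this f0 ⊢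
    rw [this, hML]
    unfold oddH
    rw [Finset.sum_range_one]
    simp only [Nat.cast_zero, zero_add, pow_zero, pow_one] at *
    linear_combination (-L) * hss
  | succ n ih =>
    have := e (n + 1)
    have f1 := f (n + 1)
    push_cast at this f1 ih ⊢
    rw [this, ih, hML]
    unfold oddH
    rw [Finset.sum_range_succ _ (n + 1)]
    push_cast
    linear_combination (-L) * hss + f1
lemma ff_inner_n (p q : ℕ) (s : ℝ) (hp : 1 ≤ p) (hq : 2 ≤ q) (k : ℕ) :
    ∑' n : ℤ, ff p q s k n = s ^ k * (RR p q k - tauv q * (1 / ((k : ℝ) + 1) ^ p)) := by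
  have h1 := (RR_gen_summable p q k (by omega)).hasSum
  have h2 := (sum_half_int' q hq).hasSum.mul_right (1 / ((k : ℝ) + 1) ^ p)
  have h3 := (h1.sub h2).mul_left (s ^ k)
  refine HasSum.tsum_eq (hs_congr h3 fun n => ?_)
  unfold ff
  rw [← one_div_mul_one_div]
  ring

lemma ff_inner_k (p q : ℕ) (s : ℝ) (n : ℤ) :
    ∑' k : ℕ, ff p q s k n = EE p s n * (1 / ((n : ℝ) + 1 / 2) ^ q) := by
  unfold ff EE
  rw [tsum_mul_right]

lemma I_mem (S : Subalgebra ℚ ℝ) (hpi : Real.pi ∈ S) (hz : ∀ k, 1 ≤ k → zetaVal (2 * k + 1) ∈ S)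
    (p q : ℕ) (s : ℝ) (hs : s = 1 ∨ s = -1) (hp : 1 ≤ p) (hq : 2 ≤ q) (hpq : Odd (p + q)) :
    ∃ I ∈ S, HasSum (fun n : ℤ => EE p s n * (1 / ((n : ℝ) + 1 / 2) ^ q)) I := by
  have hF := ff_summable p q s hs hp hq
  have h1 := hF.prod_symm.prod
  have h2 : Summable (fun n : ℤ => EE p s n * (1 / ((n : ℝ) + 1 / 2) ^ q)) := by
    refine sm_congr h1 fun n => ?_
    rw [← ff_inner_k]; rfl
  refine ⟨_, ?_, h2.hasSum⟩
  have h3 := hF.tsum_comm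
  simp_rw [ff_inner_k, ff_inner_n p q s hp hq] at h3
  rw [h3]
  have h4 := RR_mem S hpi (p - 1 + (q - 1)) (p - 1) (q - 1) rfl
  rw [show p - 1 + 1 = p by omega, show q - 1 + 1 = q by omega,
    show p - 1 + (q - 1) + 2 = p + q by omega] at h4
  have h5 := Submodule.add_mem _ h4 (WW_tau S hpi (p + q) q p hq (by omega) hp)
  have h6 := (WW_sum S hz s hs (p + q) hpq _ h5).2
  refine (congrArg (· ∈ S) (tsum_congr fun k => ?_)).mpr h6
  simp only [Pi.add_apply]
  ring

lemma main_mem (S : Subalgebra ℚ ℝ) (hpi : Real.pi ∈ S) (hz : ∀ k, 1 ≤ k → zetaVal (2 * k + 1) ∈ S)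
    (p q : ℕ) (s : ℝ) (hs : s = 1 ∨ s = -1) (hp : 1 ≤ p) (hq : 2 ≤ q) (hpq : Odd (p + q)) (L X : ℝ)
    (hM : Tendsto (fun K : ℕ => (s - 1) * ∑ k ∈ Finset.range K, s ^ k / ((k : ℝ) + 1) ^ p) atTop
      (𝓝 ((s - 1) * L)))
    (hX : HasSum (fun n : ℕ => s ^ n / ((n : ℝ) + 1 / 2) ^ q) X)
    (hB : (EE p s 0 + L) * (1 + (-1) ^ q * s) * X ∈ S)
    (hL : L * (1 + (-1) ^ q) * tval q ∈ S) : TSum p q s s ∈ S := by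
  obtain ⟨I, hI, hsum⟩ := I_mem S hpi hz p q s hs hp hq hpq
  have hrec := EE_rec p s hs hp _ hM
  have hss : s * s = 1 := by rcases hs with rfl | rfl <;> simp
  have hsS : s ∈ S := by
    rcases hs with rfl | rfl
    · exact S.one_mem
    · exact S.neg_mem S.one_mem
  have hnS : (-1 : ℝ) ∈ S := S.neg_mem S.one_mem
  have h1 := hsum.nat_add_neg_add_one
  have h2 := ((h1.sub (hX.mul_left ((EE p s 0 + L) * (1 + (-1) ^ q * s)))).add
    ((sum_half_nat q hq).hasSum.mul_left (L * (1 + (-1) ^ q)))).add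
    ((sum_half_nat (p + q) (by omega)).hasSum.mul_left ((-1) ^ q * s))
  have hc : ∃ r : ℚ, (r : ℝ) * (s * ((-1) ^ p - (-1) ^ q)) = 1 := by
    rcases Nat.even_or_odd p with he | ho
    · have hqo : Odd q := by
        rcases Nat.even_or_odd q with h | h
        · exact absurd (he.add h) (Nat.not_even_iff_odd.2 hpq)
        · exact h
      rw [he.neg_one_pow, hqo.neg_one_pow]
      rcases hs with rfl | rfl
      · exact ⟨1 / 2, by norm_num⟩
      · exact ⟨-1 / 2, by norm_num⟩
    · have hqe : Even q := by
        rcases Nat.even_or_odd q with h | h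
        · exact h
        · exact absurd (ho.add_odd h) (Nat.not_even_iff_odd.2 hpq)
      rw [ho.neg_one_pow, hqe.neg_one_pow]
      rcases hs with rfl | rfl
      · exact ⟨-1 / 2, by norm_num⟩
      · exact ⟨1 / 2, by norm_num⟩
  obtain ⟨r, hr⟩ := hc
  have h3 := h2.mul_left (r : ℝ)
  have h4 := hs_congr (g := fun n : ℕ => s ^ n * oddH n p s / ((n : ℝ) + 1 / 2) ^ q) h3 (fun n => by
    rw [EE_nat p s hs _ L rfl hrec n, EE_neg p s hs _ L rfl hrec n]
    have e1 : (((-((n : ℤ) + 1) : ℤ) : ℝ) + 1 / 2) = -1 * ((n : ℝ) + 1 / 2) := by push_cast; ring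
    have hsn : s ^ n * s ^ n = 1 := by rw [← mul_pow, hss, one_pow]
    have hqq : (-1 : ℝ) ^ q * (-1) ^ q = 1 := by rw [← mul_pow]; simp
    have e2 : 1 / ((-1 : ℝ) * ((n : ℝ) + 1 / 2)) ^ q = (-1) ^ q * (1 / ((n : ℝ) + 1 / 2) ^ q) := by
      rw [mul_pow]
      rcases neg_one_pow_eq_or ℝ q with h | h <;> rw [h] <;> simp
    have e3 : oddH (n + 1) p s = oddH n p s + s ^ n * (1 / ((n : ℝ) + 1 / 2) ^ p) := by
      unfold oddH; rw [Finset.sum_range_succ]; ring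
    have e4 : 1 / ((n : ℝ) + 1 / 2) ^ (p + q) = (1 / ((n : ℝ) + 1 / 2) ^ p) * (1 / ((n : ℝ) + 1 / 2) ^ q) := by
      rw [pow_add, one_div_mul_one_div]
    rw [e1, e2, e3, e4, div_eq_mul_one_div _ (((n : ℝ) + 1 / 2) ^ q),
      div_eq_mul_one_div (s ^ n) (((n : ℝ) + 1 / 2) ^ q)]
    simp only [Int.cast_natCast]
    generalize 1 / ((n : ℝ) + 1 / 2) ^ q = y
    generalize 1 / ((n : ℝ) + 1 / 2) ^ p = z
    generalize oddH n p s = H at *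
    generalize EE p s 0 = E at *
    generalize (-1 : ℝ) ^ q = b at *
    generalize (-1 : ℝ) ^ p = a at *
    rw [pow_succ]
    generalize s ^ n = t at *
    linear_combination (-t * H * y) * hr + (r * b * s * z * y) * hsn)
  unfold TSum
  rw [h4.tsum_eq]
  refine S.mul_mem (rat_mem' S r) (S.add_mem (S.add_mem (S.sub_mem hI hB) hL) ?_)
  exact S.mul_mem (S.mul_mem (S.pow_mem hnS _) hsS) (tval_odd_mem S hz _ hpq (by omega))

lemma EE_one_zero (p : ℕ) (h : 2 ≤ p) : EE p 1 0 = tval p - zetaVal p := by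
  have := ((sum_half_nat p h).hasSum.sub (sum_nat_pow p h).hasSum)
  refine HasSum.tsum_eq (hs_congr this fun k => ?_)
  rw [one_pow, one_mul, show (k : ℝ) + 1 - (((0 : ℤ) : ℝ) + 1 / 2) = k + 1 / 2 by push_cast; ring]

lemma EE_one_one : EE 1 1 0 = 2 * Real.log 2 := by
  have h := (EE_summable 1 1 (Or.inl rfl) le_rfl 0).hasSum.tendsto_sum_nat
  refine tendsto_nhds_unique h ?_
  have h2 := harm_double.const_mul 2
  refine h2.congr fun K => ?_
  rw [← alt_double]
  induction K with
  | zero => simp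
  | succ K ih =>
    rw [Finset.sum_range_succ _ K, ← ih, show 2 * (K + 1) = 2 * K + 1 + 1 by ring, Finset.sum_range_succ,
      Finset.sum_range_succ]
    have h3 : (K : ℝ) + 1 - (((0 : ℤ) : ℝ) + 1 / 2) = (2 * K + 1) / 2 := by push_cast; ring
    rw [h3]
    push_cast
    simp [pow_succ]
    field_simp
    ring

lemma EE_neg_zero (p : ℕ) (h : 2 ≤ p) : EE p (-1) 0 + etav p = bval p := by
  have h1 := (EE_summable p (-1) (Or.inr rfl) (by omega) 0).hasSum
  have h2 : Summable (fun n : ℕ => (-1 : ℝ) ^ n / ((n : ℝ) + 1) ^ p) := by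
    refine Summable.of_norm_bounded (sum_nat_pow p h) fun n => ?_
    rw [norm_div, norm_pow, norm_pow, norm_neg, norm_one, one_pow, Real.norm_eq_abs,
      abs_of_pos (by positivity)]
  refine (HasSum.tsum_eq (hs_congr (h1.add h2.hasSum) fun k => ?_)).symm
  rw [show (k : ℝ) + 1 - (((0 : ℤ) : ℝ) + 1 / 2) = k + 1 / 2 by push_cast; ring]
  ring

lemma eta_tendsto (p : ℕ) (h : 2 ≤ p) :
    Tendsto (fun K : ℕ => ∑ k ∈ Finset.range K, (-1 : ℝ) ^ k / ((k : ℝ) + 1) ^ p) atTop (𝓝 (etav p)) := by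
  have h2 : Summable (fun n : ℕ => (-1 : ℝ) ^ n / ((n : ℝ) + 1) ^ p) := by
    refine Summable.of_norm_bounded (sum_nat_pow p h) fun n => ?_
    rw [norm_div, norm_pow, norm_pow, norm_neg, norm_one, one_pow, Real.norm_eq_abs,
      abs_of_pos (by positivity)]
  exact h2.hasSum.tendsto_sum_nat

lemma parity {p q : ℕ} (h : Odd (p + q)) : (Odd p ∧ Even q) ∨ (Even p ∧ Odd q) := by
  rcases Nat.even_or_odd p with hp | hp <;> rcases Nat.even_or_odd q with hq | hq
  · exact absurd (hp.add hq) (Nat.not_even_iff_odd.2 h)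
  · exact Or.inr ⟨hp, hq⟩
  · exact Or.inl ⟨hp, hq⟩
  · exact absurd (hp.add_odd hq) (Nat.not_even_iff_odd.2 h)

lemma part_one (S : Subalgebra ℚ ℝ) (hpi : Real.pi ∈ S) (hlog : Real.log 2 ∈ S)
    (hz : ∀ k, 1 ≤ k → zetaVal (2 * k + 1) ∈ S)
    (p q : ℕ) (hp : 1 ≤ p) (hq : 2 ≤ q) (hpq : Odd (p + q)) : TSum p q 1 1 ∈ S := by
  refine main_mem S hpi hz p q 1 (Or.inl rfl) hp hq hpq 0 (tval q) (by simp) ?_ ?_ (by simp)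
  · simp only [one_pow]; exact (sum_half_nat q hq).hasSum
  · rcases parity hpq with ⟨h1, h2⟩ | ⟨h1, h2⟩
    · rw [add_zero]
      refine S.mul_mem (S.mul_mem ?_ ?_) (tval_even_mem S hpi q h2 hq)
      · rcases Nat.lt_or_ge 1 p with h | h
        · rw [EE_one_zero p h]
          exact S.sub_mem (tval_odd_mem S hz p h1 h) (zeta_odd_mem S hz p h1 h)
        · obtain rfl : p = 1 := by omega
          rw [EE_one_one]
          have := rat_mem' S 2
          push_cast at this
          exact S.mul_mem this hlog
      · exact S.add_mem S.one_mem (S.mul_mem (S.pow_mem (S.neg_mem S.one_mem) _) S.one_mem)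
    · rw [h2.neg_one_pow]; simp

lemma part_two (S : Subalgebra ℚ ℝ) (hpi : Real.pi ∈ S) (hlog : Real.log 2 ∈ S)
    (hz : ∀ k, 1 ≤ k → zetaVal (2 * k + 1) ∈ S) (hb : ∀ k, 1 ≤ k → betaVal (2 * k) ∈ S)
    (p q : ℕ) (hp : 1 ≤ p) (hq : 2 ≤ q) (hpq : Odd (p + q)) : TSum p q (-1) (-1) ∈ S := by
  have hX : HasSum (fun n : ℕ => (-1 : ℝ) ^ n / ((n : ℝ) + 1 / 2) ^ q) (bval q) := (sum_bval q hq).hasSum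
  rcases parity hpq with ⟨h1, h2⟩ | ⟨h1, h2⟩
  · have hL : ∃ L ∈ S, Tendsto (fun K : ℕ => ∑ k ∈ Finset.range K, (-1 : ℝ) ^ k / ((k : ℝ) + 1) ^ p) atTop (𝓝 L) := by
      rcases Nat.lt_or_ge 1 p with h | h
      · exact ⟨_, etav_odd_mem S hz p h1 h, eta_tendsto p h⟩
      · obtain rfl : p = 1 := by omega
        exact ⟨_, hlog, alt_log⟩
    obtain ⟨L, hLS, hL⟩ := hL
    refine main_mem S hpi hz p q (-1) (Or.inr rfl) hp hq hpq L (bval q) (hL.const_mul _) hX ?_ ?_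
    · rw [h2.neg_one_pow]; simp
    · refine S.mul_mem (S.mul_mem hLS ?_) (tval_even_mem S hpi q h2 hq)
      exact S.add_mem S.one_mem (S.pow_mem (S.neg_mem S.one_mem) _)
  · have hp2 : 2 ≤ p := by obtain ⟨r, rfl⟩ := h1; omega
    have bm : ∀ m, betaVal m ∈ S → bval m ∈ S := by
      intro m hm
      rw [bval_eq]
      have := rat_mem' S (2 ^ m)
      push_cast at this
      exact S.mul_mem this hm
    refine main_mem S hpi hz p q (-1) (Or.inr rfl) hp hq hpq (etav p) (bval q)
      ((eta_tendsto p hp2).const_mul _) hX ?_ ?_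
    · rw [EE_neg_zero p hp2]
      refine S.mul_mem (S.mul_mem (bm p ?_) ?_) (bm q (beta_odd_mem S hpi q h2 hq))
      · obtain ⟨r, rfl⟩ := h1
        rw [← two_mul]; exact hb r (by omega)
      · exact S.add_mem S.one_mem (S.mul_mem (S.pow_mem (S.neg_mem S.one_mem) _) (S.neg_mem S.one_mem))
    · rw [h2.neg_one_pow]; simp

/-- For `q = 1` the alternating series converges only conditionally, so the unconditional sum
in the frozen definition takes its default value. -/
lemma TSum_q_one (p : ℕ) (hp : 1 ≤ p) : TSum p 1 (-1) (-1) = 0 := by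
  unfold TSum
  apply tsum_eq_zero_of_not_summable
  intro hsum
  set c : ℝ := 1 / (1 / 2 : ℝ) ^ p - 1 / (3 / 2 : ℝ) ^ p with hc
  have hc0 : 0 < c := by
    have : (1 / 2 : ℝ) ^ p < (3 / 2 : ℝ) ^ p := pow_lt_pow_left₀ (by norm_num) (by norm_num) (by omega)
    have := one_div_lt_one_div_of_lt (by positivity) this
    linarith
  have hlow : ∀ m : ℕ, c ≤ oddH (2 * m + 2) p (-1) := by
    intro m
    induction m with
    | zero =>
      unfold oddH
      rw [Finset.sum_range_succ, Finset.sum_range_one, hc]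
      norm_num
      rw [neg_div]
      apply le_of_eq; ring
    | succ m ih =>
      have e : oddH (2 * (m + 1) + 2) p (-1) = oddH (2 * m + 2) p (-1)
          + (1 / ((2 * m + 2 : ℝ) + 1 / 2) ^ p - 1 / ((2 * m + 3 : ℝ) + 1 / 2) ^ p) := by
        unfold oddH
        rw [show 2 * (m + 1) + 2 = 2 * m + 2 + 1 + 1 by ring, Finset.sum_range_succ, Finset.sum_range_succ]
        push_cast
        have a1 : (-1 : ℝ) ^ (2 * m + 2) = 1 := by rw [pow_add, pow_mul]; simp
        have a2 : (2 * (m : ℝ) + 2 + 1) = 2 * m + 3 := by ring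
        simp only [pow_succ (-1 : ℝ) (2 * m + 2), a1, a2, one_mul, neg_div]
        ring
      have : 1 / ((2 * m + 3 : ℝ) + 1 / 2) ^ p ≤ 1 / ((2 * m + 2 : ℝ) + 1 / 2) ^ p := by
        gcongr
        norm_num
      rw [e]; linarith
  have h1 := hsum.comp_injective (i := fun m : ℕ => 2 * m + 2) (fun a b h => by simpa using h)
  have h2 : Summable (fun m : ℕ => c / 2 * (1 / ((m : ℝ) + 2))) := by
    refine Summable.of_nonneg_of_le (fun m => by positivity) (fun m => ?_) h1
    simp only [Function.comp]
    have : (-1 : ℝ) ^ (2 * m + 2) = 1 := by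
      rw [pow_add, pow_mul]; simp
    rw [this, one_mul, pow_one]
    push_cast
    calc c / 2 * (1 / ((m : ℝ) + 2)) = c / (2 * m + 4) := by field_simp; ring
      _ ≤ c / (2 * m + 2 + 1 / 2) := div_le_div_of_nonneg_left hc0.le (by positivity) (by linarith)
      _ ≤ _ := by gcongr; exact hlow m
  have h3 := h2.mul_left (2 / c)
  have h4 : Summable (fun m : ℕ => 1 / ((m + 2 : ℕ) : ℝ)) := by
    refine sm_congr h3 fun m => ?_
    push_cast
    field_simp
  exact Real.not_summable_one_div_natCast ((summable_nat_add_iff 2).1 h4)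

theorem stmt2 :
    (∀ p q : ℕ, 1 ≤ p → 2 ≤ q → Odd (p + q) →
      TSum p q 1 1 ∈ Algebra.adjoin ℚ
        ({Real.pi, Real.log 2} ∪ {x : ℝ | ∃ k : ℕ, 1 ≤ k ∧ x = zetaVal (2 * k + 1)})) ∧
    (∀ p q : ℕ, 1 ≤ p → 1 ≤ q → Odd (p + q) →
      TSum p q (-1) (-1) ∈ Algebra.adjoin ℚ
        ({Real.pi, Real.log 2, betaVal 2}
          ∪ {x : ℝ | ∃ k : ℕ, 1 ≤ k ∧ x = zetaVal (2 * k + 1)}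
          ∪ {x : ℝ | ∃ k : ℕ, 2 ≤ k ∧ x = betaVal (2 * k)})) := by
  constructor
  · intro p q hp hq hpq
    refine part_one _ ?_ ?_ ?_ p q hp hq hpq
    · exact Algebra.subset_adjoin (by simp)
    · exact Algebra.subset_adjoin (by simp)
    · exact fun k hk => Algebra.subset_adjoin (Or.inr ⟨k, hk, rfl⟩)
  · intro p q hp hq hpq
    rcases Nat.lt_or_ge 1 q with h | h
    · refine part_two _ ?_ ?_ ?_ ?_ p q hp h hpq
      · exact Algebra.subset_adjoin (by simp)
      · exact Algebra.subset_adjoin (by simp)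
      · exact fun k hk => Algebra.subset_adjoin (Or.inl (Or.inr ⟨k, hk, rfl⟩))
      · intro k hk
        rcases Nat.lt_or_ge 1 k with h | h
        · exact Algebra.subset_adjoin (Or.inr ⟨k, h, rfl⟩)
        · obtain rfl : k = 1 := by omega
          exact Algebra.subset_adjoin (by simp)
    · obtain rfl : q = 1 := by omega
      rw [TSum_q_one p hp]
      exact Subalgebra.zero_mem _
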